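/- Let G be a digraph on N and let S be the set of vertices of G with no in-neighbors (sources). Let H be the induced subdigraph of G on N∖S. Let e be a specialized equilibrium of the public goods game on G and let e|_H denote its restriction to the players in H. Then e is a stable equilibrium of the game on G if and only if e|_H is a stable specialized equilibrium of the game on H. -/

import Mathlib

/-- `e` is a specialized equilibrium of the public goods game on the digraph with
finite vertex type `V` and adjacency `g`, with threshold `e* > 0`: each player
contributes `0` when the spillovers received reach `e*`, and `e*` otherwise. -/
def IsSpecEq {V : Type*} [Finite V] (g : V → V → ℝ) (estar : ℝ) (e : V → ℝ) : Prop :=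
  ∀ i, (estar ≤ ∑ᶠ j, g i j * e j → e i = 0) ∧ (∑ᶠ j, g i j * e j < estar → e i = estar)

/-- The best-response map of the public goods game on the digraph `g` with
threshold `e*`: `f i (e) = max (0, e* - ∑ j, g i j * e j)`. -/
noncomputable def brMap {V : Type*} [Finite V] (g : V → V → ℝ) (estar : ℝ)
    (e : V → ℝ) : V → ℝ :=
  fun i => max 0 (estar - ∑ᶠ j, g i j * e j)

/-- `e` is a stable equilibrium of the public goods game on `g`: for some `ρ > 0`,
the best-response iterates from any legitimate perturbation of `e` of size at most
`ρ` converge back to `e`. -/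
def StableEq {V : Type*} [Finite V] (g : V → V → ℝ) (estar : ℝ) (e : V → ℝ) : Prop :=
  ∃ ρ > (0 : ℝ), ∀ ε : V → ℝ,
    (∀ i, |ε i| ≤ ρ) → (∀ i, 0 ≤ e i + ε i) →
    Filter.Tendsto (fun r : ℕ => (brMap g estar)^[r] (fun i => e i + ε i))
      Filter.atTop (nhds e)

open Filter Topology

section Restriction

variable {V : Type*} {g : V → V → ℝ} {S : Set V}

/-- Vertices whose column in `g` vanishes do not contribute to spillovers. -/
lemma finsum_spillover_restrict (hS : ∀ j ∈ S, ∀ i, g i j = 0) (i : V) (x : V → ℝ) :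
    ∑ᶠ j : {j // j ∉ S}, g i j * x j = ∑ᶠ j, g i j * x j := by
  rw [finsum_subtype_eq_finsum_cond (f := fun j => g i j * x j) (fun j => j ∉ S)]
  refine finsum_congr fun j => ?_
  by_cases hj : j ∈ S
  · simp [hj, hS j hj i]
  · simp [hj]

variable [Finite V] {estar : ℝ}

lemma brMap_iterate_restrict (hS : ∀ j ∈ S, ∀ i, g i j = 0) (x : V → ℝ) (r : ℕ) :
    (brMap (fun a b : {i // i ∉ S} => g a b) estar)^[r] (fun v => x v) =
      fun v : {i // i ∉ S} => (brMap g estar)^[r] x v := by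
  induction r with
  | zero => rfl
  | succ r ih =>
    rw [Function.iterate_succ_apply', ih, Function.iterate_succ_apply']
    funext v
    simp only [brMap]
    rw [finsum_spillover_restrict hS v.1 ((brMap g estar)^[r] x)]

lemma IsSpecEq.restrict {e : V → ℝ} (he : IsSpecEq g estar e)
    (hS : ∀ j ∈ S, ∀ i, g i j = 0) :
    IsSpecEq (fun a b : {i // i ∉ S} => g a b) estar (fun v => e v) := by
  intro v
  rw [finsum_spillover_restrict hS v.1 e]
  exact he v

end Restriction

section SpecEq

variable {V : Type*} [Finite V] {g : V → V → ℝ} {estar : ℝ} {e : V → ℝ}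

lemma IsSpecEq.eq_zero_or_eq (he : IsSpecEq g estar e) (i : V) : e i = 0 ∨ e i = estar :=
  (le_or_gt estar _).imp (he i).1 (he i).2

lemma IsSpecEq.nonneg (he : IsSpecEq g estar e) (hestar : 0 < estar) (i : V) : 0 ≤ e i := by
  rcases he.eq_zero_or_eq i with h | h <;> rw [h]
  exact hestar.le

lemma IsSpecEq.brMap_eq (he : IsSpecEq g estar e) (hestar : 0 < estar)
    (hg : ∀ i j, g i j = 0 ∨ g i j = 1) : brMap g estar e = e := by
  have := Fintype.ofFinite V
  funext i
  simp only [brMap]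
  rcases le_or_gt estar (∑ᶠ j, g i j * e j) with h | h
  · rw [(he i).1 h, max_eq_left (sub_nonpos.2 h)]
  · have hnonneg : ∀ j ∈ Finset.univ, 0 ≤ g i j * e j := fun j _ =>
      mul_nonneg (by rcases hg i j with h | h <;> simp [h]) (he.nonneg hestar j)
    have hzero : ∀ j, g i j * e j = 0 := by
      intro j
      have hj := Finset.single_le_sum hnonneg (Finset.mem_univ j)
      rw [← finsum_eq_sum_of_fintype] at hj
      rcases hg i j with h1 | h1
      · simp [h1]
      · rcases he.eq_zero_or_eq j with h2 | h2
        · simp [h2]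
        · rw [h1, h2, one_mul] at hj
          exact absurd h hj.not_gt
    rw [(he i).2 h]
    simp [hzero, hestar.le]

/-- If the best-response iterates converge to a fixed point at every vertex outside `S`,
and `S` does not contribute to spillovers, then they converge everywhere. -/
lemma tendsto_iterate_brMap_of_restrict {S : Set V} (hS : ∀ j ∈ S, ∀ i, g i j = 0)
    (hfix : brMap g estar e = e) (x : V → ℝ)
    (h : ∀ j ∉ S, Tendsto (fun r : ℕ => (brMap g estar)^[r] x j) atTop (𝓝 (e j))) :
    Tendsto (fun r : ℕ => (brMap g estar)^[r] x) atTop (𝓝 e) := by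
  have := Fintype.ofFinite V
  rw [tendsto_pi_nhds]
  intro i
  rw [← tendsto_add_atTop_iff_nat 1]
  simp only [Function.iterate_succ_apply']
  conv => rhs; rw [← hfix]
  simp only [brMap, finsum_eq_sum_of_fintype]
  refine tendsto_const_nhds.max (tendsto_const_nhds.sub (tendsto_finsetSum _ fun j _ => ?_))
  by_cases hj : j ∈ S
  · simp [hS j hj i]
  · exact (h j hj).const_mul _

end SpecEq

/-- Let `S` be the set of sources of `g` (vertices with no
in-neighbors) and `H` the induced subdigraph on the complement of `S`. A specialized
equilibrium `e` of the game on `g` is stable iff its restriction to the players of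
`H` is a stable specialized equilibrium of the game on `H`. -/
theorem stable_iff_stable_without_sources
    {n : ℕ} (g : Fin n → Fin n → ℝ)
    (hg01 : ∀ i j, g i j = 0 ∨ g i j = 1) (hgdiag : ∀ i, g i i = 0)
    (estar : ℝ) (hestar : 0 < estar)
    (S : Set (Fin n)) (hS : S = {i | ∀ j, g j i = 0})
    (e : Fin n → ℝ) (he : IsSpecEq g estar e) :
    StableEq g estar e ↔
      (IsSpecEq (fun a b : {i : Fin n // i ∉ S} => g a.1 b.1) estar (fun v => e v.1) ∧
       StableEq (fun a b : {i : Fin n // i ∉ S} => g a.1 b.1) estar (fun v => e v.1)) := by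
  have hS' : ∀ j ∈ S, ∀ i, g i j = 0 := by
    subst hS
    exact fun j hj => hj
  have hnonneg := he.nonneg hestar
  constructor
  · rintro ⟨ρ, hρ, h⟩
    refine ⟨he.restrict hS', ρ, hρ, fun ε hε hpos => ?_⟩
    classical
    let ε' : Fin n → ℝ := fun i => if hi : i ∉ S then ε ⟨i, hi⟩ else 0
    have hε' : ∀ v : {i : Fin n // i ∉ S}, ε' v = ε v := fun v => dif_pos v.2
    have hlim := h ε'
      (fun i => by
        by_cases hi : i ∈ S
        · simp [ε', hi, hρ.le]
        · simpa [ε', hi] using hε ⟨i, hi⟩)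
      (fun i => by
        by_cases hi : i ∈ S
        · simpa [ε', hi] using hnonneg i
        · simpa [ε', hi] using hpos ⟨i, hi⟩)
    have hrestr := brMap_iterate_restrict (estar := estar) hS' (fun i => e i + ε' i)
    simp only [hε'] at hrestr
    simp only [hrestr]
    exact tendsto_pi_nhds.2 fun v => tendsto_pi_nhds.1 hlim v
  · rintro ⟨-, ρ, hρ, h⟩
    refine ⟨ρ, hρ, fun ε hε hpos => ?_⟩
    refine tendsto_iterate_brMap_of_restrict hS' (he.brMap_eq hestar hg01) _ fun j hj => ?_
    have hlim := h (fun v => ε v) (fun v => hε v) (fun v => hpos v)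
    simp only [brMap_iterate_restrict (estar := estar) hS' (fun i => e i + ε i)] at hlim
    exact tendsto_pi_nhds.1 hlim ⟨j, hj⟩
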